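/- Let A ∈ ℂ^{N×N}, v ∈ ℂᴺ, b ∈ ℂᴺ, and φ(z) = Az + b. Define T = C_φ ∘ D_v on entire functions on ℂᴺ, i.e., Tf(z) = df(φ(z))(v). Then for every k ≥ 1 and every entire f, T^k f(z) = (d^k f)^∨(φ^k z)(v, Av, ..., A^{k-1}v), where (d^k f)^∨(w) is the symmetric k-linear form associated to the k-th differential of f at w. -/

import Mathlib

open Metric Set MeasureTheory

section EntireFunctions

variable {E : Type*} [NormedAddCommGroup E] [NormedSpace ℂ E]

/-- Cauchy's integral formula for a directional derivative of an entire function. -/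
theorem Differentiable.fderiv_apply_eq_circleIntegral {f : E → ℂ} (hf : Differentiable ℂ f)
    (z v : E) :
    fderiv ℂ f z v =
      (2 * Real.pi * Complex.I : ℂ)⁻¹ • ∮ ζ in C(0, 1), ((ζ - 0) ^ 2)⁻¹ • f (z + ζ • v) := by
  have hline : Differentiable ℂ fun ζ : ℂ => f (z + ζ • v) :=
    hf.comp ((differentiable_const z).add (differentiable_id.smul_const v))
  rw [Complex.two_pi_I_inv_smul_circleIntegral_sub_sq_inv_smul_of_differentiable
    (f := fun ζ : ℂ => f (z + ζ • v)) isOpen_univ (subset_univ _) hline.differentiableOn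
    (mem_ball_self one_pos)]
  rw [← (hf z).lineDeriv_eq_fderiv, lineDeriv]

variable [FiniteDimensional ℂ E]

/-- The derivative of an entire function is bounded on balls. -/
theorem Differentiable.exists_norm_fderiv_le_of_norm_le {f : E → ℂ} (hf : Differentiable ℂ f)
    (R : ℝ) : ∃ M, ∀ y, ‖y‖ ≤ R → ‖fderiv ℂ f y‖ ≤ M := by
  have : ProperSpace E := FiniteDimensional.proper ℂ E
  obtain ⟨C, hC⟩ := (isCompact_closedBall (0 : E) (R + 1)).exists_bound_of_continuousOn
    hf.continuous.continuousOn
  refine ⟨(C + C) / 1, fun y hy => ?_⟩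
  refine Complex.norm_fderiv_le_div_of_mapsTo_ball hf.differentiableOn (fun w hw => ?_) one_pos
  rw [mem_ball, dist_eq_norm] at hw
  have hw' : ‖w‖ ≤ R + 1 := by
    have := norm_add_le (w - y) y
    rw [sub_add_cancel] at this
    linarith
  rw [mem_closedBall, dist_eq_norm]
  refine (norm_sub_le _ _).trans (add_le_add (hC w ?_) (hC y ?_))
  · simpa using hw'
  · rw [mem_closedBall_zero_iff]
    linarith

/-- A directional derivative of an entire function is entire. -/
theorem Differentiable.fderiv_apply_const {f : E → ℂ} (hf : Differentiable ℂ f) (v : E) :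
    Differentiable ℂ fun z => fderiv ℂ f z v := by
  have : ProperSpace (E →L[ℂ] ℂ) := FiniteDimensional.proper ℂ _
  borelize E
  simp only [hf.fderiv_apply_eq_circleIntegral, circleIntegral]
  suffices h : Differentiable ℂ fun z : E => ∫ θ in 0..2 * Real.pi,
      _root_.deriv (circleMap 0 1) θ • ((circleMap 0 1 θ - 0) ^ 2)⁻¹ • f (z + circleMap 0 1 θ • v) from
    h.fun_const_smul _
  intro x₀
  obtain ⟨M, hM⟩ := hf.exists_norm_fderiv_le_of_norm_le (‖x₀‖ + 1 + ‖v‖)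
  set c : ℝ → ℂ := fun θ => _root_.deriv (circleMap 0 1) θ * ((circleMap 0 1 θ - 0) ^ 2)⁻¹ with hc_def
  have hc : Continuous c := by
    simp only [hc_def, deriv_circleMap, sub_zero]
    refine Continuous.mul (by fun_prop) (Continuous.inv₀ (by fun_prop) fun θ => ?_)
    exact pow_ne_zero _ (circleMap_ne_center one_ne_zero)
  have hpt : ∀ x : E, Continuous fun θ : ℝ => x + circleMap 0 1 θ • v := fun x => by fun_prop
  have hF : ∀ x : E, Continuous fun θ : ℝ => c θ • f (x + circleMap 0 1 θ • v) :=
    fun x => hc.smul (hf.continuous.comp (hpt x))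
  simp only [smul_smul]
  refine (intervalIntegral.hasFDerivAt_integral_of_dominated_of_fderiv_le
    (F := fun x θ => c θ • f (x + circleMap 0 1 θ • v))
    (F' := fun x θ => c θ • fderiv ℂ f (x + circleMap 0 1 θ • v))
    (bound := fun θ => ‖c θ‖ * M) (ball_mem_nhds x₀ one_pos)
    (Filter.Eventually.of_forall fun x => (hF x).aestronglyMeasurable)
    ((hF x₀).intervalIntegrable _ _) ?_ ?_ ?_ ?_).differentiableAt
  · exact hc.aestronglyMeasurable.smul
      ((measurable_fderiv ℂ f).comp (hpt x₀).measurable).aestronglyMeasurable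
  · refine Filter.Eventually.of_forall fun θ _ x hx => ?_
    rw [norm_smul]
    refine mul_le_mul_of_nonneg_left (hM _ ?_) (norm_nonneg _)
    rw [mem_ball, dist_eq_norm] at hx
    have h₁ := norm_add_le (x - x₀) x₀
    rw [sub_add_cancel] at h₁
    have h₂ := norm_add_le x (circleMap 0 1 θ • v)
    rw [norm_smul, norm_circleMap_zero, abs_one, one_mul] at h₂
    linarith
  · exact (hc.norm.mul continuous_const).intervalIntegrable _ _
  · refine Filter.Eventually.of_forall fun θ _ x _ => ?_
    exact ((hasFDerivAt_comp_add_right _).2 (hf _).hasFDerivAt).fun_const_smul (c θ)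

/-- Entire functions on a finite-dimensional space are smooth. -/
theorem Differentiable.contDiff_of_finiteDimensional {f : E → ℂ} (hf : Differentiable ℂ f)
    (n : ℕ) : ContDiff ℂ n f := by
  induction n generalizing f with
  | zero => exact contDiff_zero.2 hf.continuous
  | succ n ih =>
    push_cast
    exact contDiff_succ_iff_fderiv_apply.2
      ⟨hf, fun h => by simp at h, fun v => ih (hf.fderiv_apply_const v)⟩

/-- The last vector of an iterated derivative can be used to differentiate first. -/
theorem Differentiable.iteratedFDeriv_succ_apply_eq {f : E → ℂ} (hf : Differentiable ℂ f) (k : ℕ)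
    (z : E) (m : Fin (k + 1) → E) :
    iteratedFDeriv ℂ (k + 1) f z m =
      iteratedFDeriv ℂ k (fun y => fderiv ℂ f y (m (Fin.last k))) z (Fin.init m) := by
  have hd : ContDiff ℂ k (fderiv ℂ f) :=
    (hf.contDiff_of_finiteDimensional (k + 1)).fderiv_right (by norm_cast)
  rw [iteratedFDeriv_succ_apply_right]
  have := (ContinuousLinearMap.apply ℂ ℂ (m (Fin.last k))).iteratedFDeriv_comp_left
    (x := z) hd.contDiffAt (i := k) le_rfl
  exact (DFunLike.congr_fun this (Fin.init m)).symm

/-- Directional derivatives of an entire function commute. -/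
theorem Differentiable.fderiv_fderiv_apply_comm {f : E → ℂ} (hf : Differentiable ℂ f) (z u w : E) :
    fderiv ℂ (fun y => fderiv ℂ f y w) z u = fderiv ℂ (fun y => fderiv ℂ f y u) z w := by
  have hf2 := hf.contDiff_of_finiteDimensional 2
  have hd : DifferentiableAt ℂ (fderiv ℂ f) z :=
    (hf2.fderiv_right (m := 1) (by norm_num)).differentiable one_ne_zero z
  rw [fderiv_clm_apply hd (differentiableAt_const w), fderiv_clm_apply hd (differentiableAt_const u)]
  simpa using (hf2.contDiffAt.isSymmSndFDerivAt (by simp)) u w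

/-- A directional derivative commutes with the iterated derivative of an entire function. -/
theorem Differentiable.fderiv_iteratedFDeriv_apply {f : E → ℂ} (hf : Differentiable ℂ f) (k : ℕ)
    (z u : E) (m : Fin k → E) :
    fderiv ℂ (fun y => iteratedFDeriv ℂ k f y m) z u =
      iteratedFDeriv ℂ k (fun y => fderiv ℂ f y u) z m := by
  induction k generalizing f with
  | zero => simp
  | succ k ih =>
    simp only [hf.iteratedFDeriv_succ_apply_eq]
    rw [ih (hf.fderiv_apply_const _), (hf.fderiv_apply_const u).iteratedFDeriv_succ_apply_eq]
    simp only [hf.fderiv_fderiv_apply_comm _ u]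

end EntireFunctions

/-- The iterates of an affine map have the powers of its linear part as derivatives. -/
theorem Matrix.hasFDerivAt_iterate_mulVec_add {N : ℕ} (A : Matrix (Fin N) (Fin N) ℂ)
    (b : Fin N → ℂ) (k : ℕ) (z : Fin N → ℂ) :
    HasFDerivAt ((fun w => A.mulVec w + b)^[k])
      (LinearMap.toContinuousLinearMap (A ^ k).mulVecLin) z := by
  induction k with
  | zero =>
    refine (hasFDerivAt_id (𝕜 := ℂ) z).congr_fderiv ?_
    ext1 w
    simp
  | succ k ih =>
    rw [Function.iterate_succ']
    convert! ((LinearMap.toContinuousLinearMap A.mulVecLin).hasFDerivAt.add_const b).comp z ih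
      using 1
    ext1 w
    simp [pow_succ']

theorem stmt_11 {N : ℕ} (A : Matrix (Fin N) (Fin N) ℂ) (b v : Fin N → ℂ)
    (f : (Fin N → ℂ) → ℂ) (hf : Differentiable ℂ f) (k : ℕ) (hk : 1 ≤ k) (z : Fin N → ℂ) :
    (fun g : (Fin N → ℂ) → ℂ => fun w => fderiv ℂ g (A.mulVec w + b) v)^[k] f z
      = iteratedFDeriv ℂ k f ((fun w => A.mulVec w + b)^[k] z)
          (fun i : Fin k => (A ^ (i : ℕ)).mulVec v) := by
  clear hk
  induction k generalizing z with
  | zero => simp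
  | succ k ih =>
    rw [Function.iterate_succ_apply', Function.iterate_succ_apply, funext ih]
    have hg : Differentiable ℂ fun y =>
        iteratedFDeriv ℂ k f y fun i : Fin k => (A ^ (i : ℕ)).mulVec v := fun y =>
      ((hf.contDiff_of_finiteDimensional (k + 1)).differentiable_iteratedFDeriv
        (by norm_cast; omega) y).continuousMultilinear_apply_const _
    have hcomp := (hg _).hasFDerivAt.comp _ (A.hasFDerivAt_iterate_mulVec_add b k (A.mulVec z + b))
    rw [Function.comp_def] at hcomp
    rw [hcomp.fderiv, hf.iteratedFDeriv_succ_apply_eq, ContinuousLinearMap.comp_apply,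
      hf.fderiv_iteratedFDeriv_apply]
    rfl
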